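/- arXiv:2411.18318 — 2 statements merged into one kernel-verified Lean document; each statement's English description precedes it below -/
import Mathlib

section
/- Let L be a nontrivial real Hilbert space and R, S : L → L operators such that at least one of R, S satisfies the chord property. Then SRG(R + S) ⊆ SRG(R) + SRG(S), where R + S is the operator u ↦ R u + S u and SRG(R) + SRG(S) := {z + w : z ∈ SRG(R), w ∈ SRG(S)} is the Minkowski sum. -/
open scoped Pointwise

/-- The pair of complex numbers
`(‖Ru₁−Ru₂‖/‖u₁−u₂‖)·exp(±i·∠(u₁−u₂, Ru₁−Ru₂))` (which reduces to `{0}` when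
`Ru₁ = Ru₂`). -/
noncomputable def zR {L : Type*} [NormedAddCommGroup L] [InnerProductSpace ℝ L]
    (R : L → L) (u₁ u₂ : L) : Set ℂ :=
  {((‖R u₁ - R u₂‖ / ‖u₁ - u₂‖ : ℝ) : ℂ) *
      Complex.exp (Complex.I * (InnerProductGeometry.angle (u₁ - u₂) (R u₁ - R u₂) : ℝ)),
   ((‖R u₁ - R u₂‖ / ‖u₁ - u₂‖ : ℝ) : ℂ) *
      Complex.exp (-(Complex.I * (InnerProductGeometry.angle (u₁ - u₂) (R u₁ - R u₂) : ℝ)))}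

/-- The Scaled Relative Graph of an operator `R`. -/
noncomputable def SRG {L : Type*} [NormedAddCommGroup L] [InnerProductSpace ℝ L]
    (R : L → L) : Set ℂ :=
  ⋃ (u₁ : L) (u₂ : L) (_ : u₁ ≠ u₂), zR R u₁ u₂

/-- An operator satisfies the chord property if for every `z` in its SRG, the closed
segment between `z` and its complex conjugate lies in the SRG. -/
def ChordProperty {L : Type*} [NormedAddCommGroup L] [InnerProductSpace ℝ L]
    (R : L → L) : Prop :=
  ∀ z ∈ SRG R, segment ℝ z ((starRingEnd ℂ) z) ⊆ SRG R

section PerpComponent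

variable {L : Type*} [NormedAddCommGroup L] [InnerProductSpace ℝ L]

/-- The component of `x` orthogonal to `d`. -/
noncomputable def perpComponent (d x : L) : L :=
  x - (inner ℝ d x / ‖d‖ ^ 2) • d

theorem perpComponent_add (d x y : L) :
    perpComponent d (x + y) = perpComponent d x + perpComponent d y := by
  simp only [perpComponent, inner_add_right, add_div, add_smul]
  abel

theorem norm_div_norm_mul_cos_angle {d : L} (hd : d ≠ 0) (x : L) :
    ‖x‖ / ‖d‖ * Real.cos (InnerProductGeometry.angle d x) = inner ℝ d x / ‖d‖ ^ 2 := by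
  have hd' : ‖d‖ ≠ 0 := norm_ne_zero_iff.mpr hd
  rw [← InnerProductGeometry.cos_angle_mul_norm_mul_norm d x]
  field_simp

theorem norm_perpComponent_sq {d : L} (hd : d ≠ 0) (x : L) :
    ‖perpComponent d x‖ ^ 2 = ‖x‖ ^ 2 - inner ℝ d x ^ 2 / ‖d‖ ^ 2 := by
  have hd' : ‖d‖ ≠ 0 := norm_ne_zero_iff.mpr hd
  rw [perpComponent, norm_sub_sq_real, inner_smul_right, norm_smul, mul_pow, Real.norm_eq_abs,
    sq_abs, real_inner_comm]
  field_simp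
  ring

theorem norm_div_norm_mul_sin_angle {d : L} (hd : d ≠ 0) (x : L) :
    ‖x‖ / ‖d‖ * Real.sin (InnerProductGeometry.angle d x) = ‖perpComponent d x‖ / ‖d‖ := by
  have hd' : ‖d‖ ≠ 0 := norm_ne_zero_iff.mpr hd
  rw [div_mul_eq_mul_div]
  congr 1
  refine (sq_eq_sq₀ (mul_nonneg (norm_nonneg x) (InnerProductGeometry.sin_angle_nonneg d x))
    (norm_nonneg _)).mp ?_
  rw [norm_perpComponent_sq hd, mul_pow, Real.sin_sq,
    ← InnerProductGeometry.cos_angle_mul_norm_mul_norm d x]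
  field_simp

theorem mem_zR_iff (R : L → L) {u₁ u₂ : L} (h : u₁ ≠ u₂) (z : ℂ) :
    z ∈ zR R u₁ u₂ ↔
      z.re = inner ℝ (u₁ - u₂) (R u₁ - R u₂) / ‖u₁ - u₂‖ ^ 2 ∧
        |z.im| = ‖perpComponent (u₁ - u₂) (R u₁ - R u₂)‖ / ‖u₁ - u₂‖ := by
  have hd : u₁ - u₂ ≠ 0 := sub_ne_zero.mpr h
  rw [← norm_div_norm_mul_cos_angle hd, ← norm_div_norm_mul_sin_angle hd,
    abs_eq (mul_nonneg (by positivity) (InnerProductGeometry.sin_angle_nonneg _ _)), and_or_left]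
  simp only [zR, Set.mem_insert_iff, Set.mem_singleton_iff, Complex.ext_iff, Complex.re_ofReal_mul,
    Complex.im_ofReal_mul, Complex.exp_re, Complex.exp_im, Complex.neg_re, Complex.neg_im,
    Complex.I_mul_re, Complex.I_mul_im, Complex.ofReal_re, Complex.ofReal_im, neg_zero,
    Real.exp_zero, one_mul, Real.cos_neg, Real.sin_neg, mul_neg]

theorem mem_SRG_iff (R : L → L) (z : ℂ) :
    z ∈ SRG R ↔ ∃ u₁ u₂, u₁ ≠ u₂ ∧ z ∈ zR R u₁ u₂ := by
  simp only [SRG, Set.mem_iUnion, exists_prop]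

theorem mem_segment_conj {x y t : ℝ} (ht : |t| ≤ y) :
    (⟨x, t⟩ : ℂ) ∈ segment ℝ (⟨x, y⟩ : ℂ) ((starRingEnd ℂ) ⟨x, y⟩) := by
  obtain ⟨h₁, h₂⟩ := abs_le.mp ht
  rcases (show 0 ≤ y by linarith).eq_or_lt with rfl | hy
  · obtain rfl : t = 0 := by linarith
    have : (starRingEnd ℂ) (⟨x, 0⟩ : ℂ) = ⟨x, 0⟩ := by simp [Complex.ext_iff]
    rw [this]
    exact left_mem_segment ℝ _ _
  · refine ⟨(y + t) / (2 * y), (y - t) / (2 * y), div_nonneg (by linarith) (by linarith),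
      div_nonneg (by linarith) (by linarith), by field_simp; ring, ?_⟩
    apply Complex.ext <;>
      simp only [Complex.add_re, Complex.add_im, Complex.smul_re, Complex.smul_im, Complex.conj_re,
        Complex.conj_im, smul_eq_mul] <;>
      field_simp <;> ring

theorem srg_add_subset_of_chordProperty_left {R : L → L} (S : L → L) (hR : ChordProperty R) :
    SRG (fun u => R u + S u) ⊆ SRG R + SRG S := by
  intro z hz
  obtain ⟨u₁, u₂, hne, hz⟩ := (mem_SRG_iff _ _).mp hz
  obtain ⟨hre, him⟩ := (mem_zR_iff _ hne z).mp hz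
  have hmem (T : L → L) (w : ℂ) (hw : _) : w ∈ SRG T :=
    (mem_SRG_iff T w).mpr ⟨u₁, u₂, hne, (mem_zR_iff T hne w).mpr hw⟩
  simp only [add_sub_add_comm, perpComponent_add, inner_add_right, add_div] at hre him
  set d := u₁ - u₂
  set p := perpComponent d (R u₁ - R u₂)
  set q := perpComponent d (S u₁ - S u₂)
  have h₁ : ‖p + q‖ / ‖d‖ ≤ ‖p‖ / ‖d‖ + ‖q‖ / ‖d‖ := by
    rw [← add_div]
    gcongr
    exact norm_add_le p q
  have h₂ : ‖q‖ / ‖d‖ ≤ ‖p + q‖ / ‖d‖ + ‖p‖ / ‖d‖ := by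
    rw [← add_div]
    gcongr
    simpa using norm_sub_le (p + q) p
  have hp : 0 ≤ ‖p‖ / ‖d‖ := by positivity
  have hq : 0 ≤ ‖q‖ / ‖d‖ := by positivity
  rw [← him] at h₁ h₂
  obtain ⟨s, hs, hsz⟩ : ∃ s : ℝ, |s| = ‖q‖ / ‖d‖ ∧ |z.im - s| ≤ ‖p‖ / ‖d‖ := by
    rcases le_total 0 z.im with h | h
    · rw [abs_of_nonneg h] at h₁ h₂
      exact ⟨_, abs_of_nonneg hq, abs_le.mpr ⟨by linarith, by linarith⟩⟩
    · rw [abs_of_nonpos h] at h₁ h₂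
      exact ⟨-(‖q‖ / ‖d‖), by rw [abs_neg, abs_of_nonneg hq],
        abs_le.mpr ⟨by linarith, by linarith⟩⟩
  refine ⟨⟨inner ℝ d (R u₁ - R u₂) / ‖d‖ ^ 2, z.im - s⟩, ?_,
    ⟨inner ℝ d (S u₁ - S u₂) / ‖d‖ ^ 2, s⟩, hmem S _ ⟨rfl, hs⟩, ?_⟩
  · exact hR _ (hmem R _ ⟨rfl, abs_of_nonneg hp⟩) (mem_segment_conj hsz)
  · exact Complex.ext hre.symm (sub_add_cancel _ _)

end PerpComponent

theorem srg_sum_subset {L : Type*} [NormedAddCommGroup L] [InnerProductSpace ℝ L]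
    [CompleteSpace L] [Nontrivial L] (R S : L → L)
    (hchord : ChordProperty R ∨ ChordProperty S) :
    SRG (fun u => R u + S u) ⊆ SRG R + SRG S := by
  rcases hchord with hR | hS
  · exact srg_add_subset_of_chordProperty_left S hR
  · simpa only [add_comm] using srg_add_subset_of_chordProperty_left R hS
end

section
/- Let (Ω, μ) be a measure space, L = L²(μ; ℝ), and let φ : ℝ → ℝ be measurable with φ(0) = 0 which satisfies the sector condition φ ∈ [k₁, k₂] for real numbers k₁ ≤ k₂, i.e., k₁·x² ≤ φ(x)·x ≤ k₂·x² for all x ∈ ℝ. Let Φ : L → L be the static nonlinearity operator (Φu)(t) = φ(u(t)) (well-defined since |φ(x)| ≤ max(|k₁|,|k₂|)·|x|). Then SG₀(Φ) ⊆ D_{[k₁,k₂]}, the closed disk in ℂ centered at (k₁+k₂)/2 on the real axis with radius (k₂−k₁)/2. -/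
open scoped Pointwise

/-- The Scaled Graph of an operator `R` at zero. -/
noncomputable def SG0 {L : Type*} [NormedAddCommGroup L] [InnerProductSpace ℝ L]
    (R : L → L) : Set ℂ :=
  ⋃ (u : L) (_ : u ≠ 0), zR R u 0

open MeasureTheory

/-- The distance from a point with modulus `‖v‖ / ‖u‖` and argument `± angle u v` to a real number
`c` is the relative distance from `v` to `c • u`. -/
theorem norm_polar_sub_ofReal {L : Type*} [NormedAddCommGroup L] [InnerProductSpace ℝ L]
    {u : L} (hu : u ≠ 0) (v : L) (c s : ℝ)
    (hs : Real.cos s = Real.cos (InnerProductGeometry.angle u v)) :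
    ‖((‖v‖ / ‖u‖ : ℝ) : ℂ) * Complex.exp (s * Complex.I) - (c : ℂ)‖ = ‖v - c • u‖ / ‖u‖ := by
  have hu' : ‖u‖ ≠ 0 := norm_ne_zero_iff.mpr hu
  rw [← sq_eq_sq₀ (norm_nonneg _) (by positivity), div_pow, norm_sub_sq_real v, norm_smul,
    mul_pow, Real.norm_eq_abs, sq_abs, inner_smul_right, real_inner_comm,
    ← InnerProductGeometry.cos_angle_mul_norm_mul_norm, ← hs, Complex.sq_norm,
    Complex.normSq_apply]
  simp only [Complex.sub_re, Complex.sub_im, Complex.re_ofReal_mul, Complex.im_ofReal_mul,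
    Complex.exp_ofReal_mul_I_re, Complex.exp_ofReal_mul_I_im, Complex.ofReal_re,
    Complex.ofReal_im]
  field_simp
  linear_combination ‖v‖ ^ 2 * Real.sin_sq_add_cos_sq s

theorem zR_subset_closedBall {L : Type*} [NormedAddCommGroup L] [InnerProductSpace ℝ L]
    {R : L → L} {u₁ u₂ : L} (hu : u₁ ≠ u₂) {c r : ℝ}
    (h : ‖R u₁ - R u₂ - c • (u₁ - u₂)‖ ≤ r * ‖u₁ - u₂‖) :
    zR R u₁ u₂ ⊆ Metric.closedBall (c : ℂ) r := by
  have hu' : u₁ - u₂ ≠ 0 := sub_ne_zero.mpr hu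
  have key (s : ℝ)
      (hs : Real.cos s = Real.cos (InnerProductGeometry.angle (u₁ - u₂) (R u₁ - R u₂))) :
      ((‖R u₁ - R u₂‖ / ‖u₁ - u₂‖ : ℝ) : ℂ) * Complex.exp (s * Complex.I) ∈
        Metric.closedBall (c : ℂ) r := by
    rw [mem_closedBall_iff_norm, norm_polar_sub_ofReal hu' _ c s hs]
    exact (div_le_iff₀ (norm_pos_iff.mpr hu')).mpr h
  rintro z (rfl | rfl)
  · simpa only [mul_comm Complex.I] using key _ rfl
  · simpa only [Complex.ofReal_neg, neg_mul, mul_comm Complex.I] using key _ (Real.cos_neg _)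

theorem abs_sub_midpoint_mul_le_of_sector {k₁ k₂ x y : ℝ} (hy : x = 0 → y = 0)
    (h₁ : k₁ * x ^ 2 ≤ y * x) (h₂ : y * x ≤ k₂ * x ^ 2) :
    |y - (k₁ + k₂) / 2 * x| ≤ (k₂ - k₁) / 2 * |x| := by
  rcases eq_or_ne x 0 with rfl | hx
  · simp [hy rfl]
  · refine le_of_mul_le_mul_right ?_ (abs_pos.mpr hx)
    rw [← abs_mul, mul_assoc, abs_mul_abs_self, abs_le]
    constructor <;> linarith

theorem sg0_static_nonlinearity_sector {Ω : Type*} [MeasurableSpace Ω]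
    (μ : Measure Ω) (φ : ℝ → ℝ) (hφ_meas : Measurable φ) (hφ0 : φ 0 = 0)
    (k₁ k₂ : ℝ) (hk : k₁ ≤ k₂)
    (hsector : ∀ x : ℝ, k₁ * x ^ 2 ≤ φ x * x ∧ φ x * x ≤ k₂ * x ^ 2)
    (Φ : Lp ℝ 2 μ → Lp ℝ 2 μ)
    (hΦ : ∀ u : Lp ℝ 2 μ, ∀ᵐ t ∂μ, (Φ u : Ω → ℝ) t = φ ((u : Ω → ℝ) t)) :
    SG0 Φ ⊆ Metric.closedBall (((k₁ + k₂) / 2 : ℝ) : ℂ) ((k₂ - k₁) / 2) := by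
  refine Set.iUnion₂_subset fun u hu => zR_subset_closedBall hu ?_
  have hΦ0 : Φ 0 = 0 := by
    refine Lp.ext ?_
    filter_upwards [hΦ 0, Lp.coeFn_zero ℝ 2 μ] with t h₁ h₂
    rw [h₁, h₂, Pi.zero_apply, hφ0]
  rw [hΦ0, sub_zero, sub_zero]
  refine Lp.norm_le_mul_norm_of_ae_le_mul ?_
  filter_upwards [hΦ u, Lp.coeFn_sub (Φ u) (((k₁ + k₂) / 2) • u),
    Lp.coeFn_smul ((k₁ + k₂) / 2) u] with t h₁ h₂ h₃
  rw [h₂, Pi.sub_apply, h₁, h₃, Pi.smul_apply, smul_eq_mul, Real.norm_eq_abs, Real.norm_eq_abs]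
  exact abs_sub_midpoint_mul_le_of_sector (fun h => h ▸ hφ0) (hsector _).1 (hsector _).2
end
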